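/- arXiv:2505.24066 — 5 statements merged into one kernel-verified Lean document; each statement's English description precedes it below -/
import Mathlib

section
/- Let f : [0,1] → ℝ be twice differentiable and suppose there exist constants 0 < c₁ < c₂ such that c₁ < |f''(x)| < c₂ for all x ∈ [0,1]. For a positive integer M and 0 ≤ k ≤ M−1, set m_k = inf_{a,b ∈ ℝ} sup_{x ∈ [k/M,(k+1)/M]} |f(x) − (a x + b)|. Then for every positive integer M and every k: c₁/(16 M²) ≤ m_k ≤ c₂/(2 M²). Consequently f satisfies the uniform nonlinearity (UN) condition: there exists K > 0 such that for every positive integer M, M · max_{0 ≤ k ≤ M−1} m_k² ≤ K · Σ_{k=0}^{M−1} m_k². -/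
open Set

/-- The second difference of a twice differentiable function is a value of its second derivative,
scaled by the square of the step. -/
theorem exists_second_difference_eq {f f' f'' : ℝ → ℝ} {p h : ℝ} (hh : 0 < h)
    (hf' : ∀ x ∈ Icc p (p + 2 * h), HasDerivWithinAt f (f' x) (Icc p (p + 2 * h)) x)
    (hf'' : ∀ x ∈ Icc p (p + 2 * h), HasDerivWithinAt f' (f'' x) (Icc p (p + 2 * h)) x) :
    ∃ y ∈ Icc p (p + 2 * h), f (p + 2 * h) - 2 * f (p + h) + f p = f'' y * h ^ 2 := by
  have hfc : ContinuousOn f (Icc p (p + 2 * h)) := fun x hx => (hf' x hx).continuousWithinAt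
  have hfc' : ContinuousOn f' (Icc p (p + 2 * h)) := fun x hx => (hf'' x hx).continuousWithinAt
  obtain ⟨ξ, hξ, hξe⟩ := exists_hasDerivAt_eq_slope (fun t => f (t + h) - f t)
    (fun t => f' (t + h) - f' t) (show p < p + h by linarith)
    ((hfc.comp (by fun_prop) fun t ht => ⟨by linarith [ht.1], by linarith [ht.2]⟩).sub
      (hfc.mono (Icc_subset_Icc_right (by linarith))))
    (fun t ht => by
      have h₁ := (hf' (t + h) ⟨by linarith [ht.1], by linarith [ht.2]⟩).hasDerivAt
        (Icc_mem_nhds (by linarith [ht.1]) (by linarith [ht.2]))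
      have h₂ := (hf' t ⟨by linarith [ht.1], by linarith [ht.2]⟩).hasDerivAt
        (Icc_mem_nhds (by linarith [ht.1]) (by linarith [ht.2]))
      exact (h₁.comp_add_const t h).sub h₂)
  obtain ⟨y, hy, hye⟩ := exists_hasDerivAt_eq_slope f' f'' (show ξ < ξ + h by linarith)
    (hfc'.mono (Icc_subset_Icc (by linarith [hξ.1]) (by linarith [hξ.2])))
    (fun t ht => (hf'' t ⟨by linarith [ht.1, hξ.1], by linarith [ht.2, hξ.2]⟩).hasDerivAt
      (Icc_mem_nhds (by linarith [ht.1, hξ.1]) (by linarith [ht.2, hξ.2])))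
  refine ⟨y, ⟨by linarith [hy.1, hξ.1], by linarith [hy.2, hξ.2]⟩, ?_⟩
  rw [add_sub_cancel_left, eq_div_iff hh.ne'] at hξe hye
  have hp : p + h + h = p + 2 * h := by ring
  rw [hp] at hξe
  linear_combination -hξe - h * hye

/-- On an interval of radius `h`, the tangent line at the midpoint approximates `f` within
`c * h ^ 2` when `|f''| ≤ c`. -/
theorem abs_sub_midpoint_tangent_le {f f' f'' : ℝ → ℝ} {p h c : ℝ} (hh : 0 < h)
    (hf' : ∀ x ∈ Icc p (p + 2 * h), HasDerivWithinAt f (f' x) (Icc p (p + 2 * h)) x)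
    (hf'' : ∀ x ∈ Icc p (p + 2 * h), HasDerivWithinAt f' (f'' x) (Icc p (p + 2 * h)) x)
    (hc : ∀ x ∈ Icc p (p + 2 * h), |f'' x| ≤ c) {x : ℝ} (hx : x ∈ Icc p (p + 2 * h)) :
    |f x - (f' (p + h) * x + (f (p + h) - f' (p + h) * (p + h)))| ≤ c * h ^ 2 := by
  have hq : p + h ∈ Icc p (p + 2 * h) := ⟨by linarith, by linarith⟩
  have hc0 : 0 ≤ c := (abs_nonneg _).trans (hc _ hq)
  have hdist : ∀ y ∈ Icc p (p + 2 * h), |y - (p + h)| ≤ h := fun y hy =>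
    abs_le.2 ⟨by linarith [hy.1], by linarith [hy.2]⟩
  have hslope : ∀ y ∈ Icc p (p + 2 * h), ‖f' y - f' (p + h)‖ ≤ c * h := fun y hy =>
    ((convex_Icc _ _).norm_image_sub_le_of_norm_hasDerivWithin_le hf'' hc hq hy).trans
      (mul_le_mul_of_nonneg_left (hdist y hy) hc0)
  have hg : ∀ y ∈ Icc p (p + 2 * h), HasDerivWithinAt (fun t => f t - f' (p + h) * t)
      (f' y - f' (p + h)) (Icc p (p + 2 * h)) y := fun y hy => by
    have hlin := (hasDerivWithinAt_id y (Icc p (p + 2 * h))).const_mul (f' (p + h))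
    rw [mul_one] at hlin
    exact (hf' y hy).sub hlin
  have key := ((convex_Icc _ _).norm_image_sub_le_of_norm_hasDerivWithin_le hg hslope hq hx).trans
    (mul_le_mul_of_nonneg_left (hdist x hx) (mul_nonneg hc0 hh.le))
  rw [Real.norm_eq_abs] at key
  calc _ = |f x - f' (p + h) * x - (f (p + h) - f' (p + h) * (p + h))| := by rw [sub_sub]
    _ ≤ c * h * h := key
    _ = c * h ^ 2 := by ring

/-- An affine function approximating `f` within `S` on `[p, p + 2h]` forces the second difference
of `f` to be at most `4 * S`. -/
theorem abs_second_difference_le_of_affine_approx {f : ℝ → ℝ} {p h a b S : ℝ} (hh : 0 < h)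
    (hS : ∀ x ∈ Icc p (p + 2 * h), |f x - (a * x + b)| ≤ S) :
    |f (p + 2 * h) - 2 * f (p + h) + f p| ≤ 4 * S := by
  have h₀ := abs_le.1 (hS p ⟨by linarith, by linarith⟩)
  have h₁ := abs_le.1 (hS (p + h) ⟨by linarith, by linarith⟩)
  have h₂ := abs_le.1 (hS (p + 2 * h) ⟨by linarith, by linarith⟩)
  exact abs_le.2 ⟨by linarith [h₀.1, h₁.2, h₂.1], by linarith [h₀.2, h₁.1, h₂.2]⟩

/-- A continuous function on a compact interval is bounded by the nested supremum of its
absolute value. -/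
theorem abs_le_biSup_of_continuousOn_Icc {g : ℝ → ℝ} {u v x : ℝ}
    (hg : ContinuousOn g (Icc u v)) (hx : x ∈ Icc u v) :
    |g x| ≤ ⨆ y ∈ Icc u v, |g y| := by
  obtain ⟨C, hC⟩ := isCompact_Icc.exists_bound_of_continuousOn hg
  have hbdd : BddAbove (range fun y => ⨆ _ : y ∈ Icc u v, |g y|) := by
    refine ⟨max C 0, ?_⟩
    rintro _ ⟨y, rfl⟩
    exact Real.iSup_le (fun hy => (hC y hy).trans (le_max_left _ _)) (le_max_right _ _)
  exact (ciSup_pos (f := fun _ => |g x|) hx).symm.le.trans (le_ciSup hbdd x)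

/-- Two-sided bounds for the best affine approximation error on an interval of length `2 * h`. -/
theorem affine_approx_error_bounds {f f' f'' : ℝ → ℝ} {p h c₁ c₂ : ℝ} (hh : 0 < h)
    (hf' : ∀ x ∈ Icc p (p + 2 * h), HasDerivWithinAt f (f' x) (Icc p (p + 2 * h)) x)
    (hf'' : ∀ x ∈ Icc p (p + 2 * h), HasDerivWithinAt f' (f'' x) (Icc p (p + 2 * h)) x)
    (hc₁ : ∀ x ∈ Icc p (p + 2 * h), c₁ ≤ |f'' x|)
    (hc₂ : ∀ x ∈ Icc p (p + 2 * h), |f'' x| ≤ c₂) :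
    c₁ * h ^ 2 / 4 ≤ (⨅ (a : ℝ) (b : ℝ), ⨆ x ∈ Icc p (p + 2 * h), |f x - (a * x + b)|) ∧
      (⨅ (a : ℝ) (b : ℝ), ⨆ x ∈ Icc p (p + 2 * h), |f x - (a * x + b)|) ≤ c₂ * h ^ 2 := by
  have hfc : ContinuousOn f (Icc p (p + 2 * h)) := fun x hx => (hf' x hx).continuousWithinAt
  have hnn : ∀ a b : ℝ, 0 ≤ ⨆ x ∈ Icc p (p + 2 * h), |f x - (a * x + b)| := fun a b =>
    Real.iSup_nonneg fun x => Real.iSup_nonneg fun _ => abs_nonneg _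
  constructor
  · refine le_ciInf fun a => le_ciInf fun b => ?_
    obtain ⟨y, hy, hye⟩ := exists_second_difference_eq hh hf' hf''
    have hS := abs_second_difference_le_of_affine_approx (a := a) (b := b) hh fun x hx =>
      abs_le_biSup_of_continuousOn_Icc (g := fun x => f x - (a * x + b))
        (hfc.sub (by fun_prop)) hx
    rw [hye, abs_mul, abs_of_nonneg (sq_nonneg h)] at hS
    have := mul_le_mul_of_nonneg_right (hc₁ y hy) (sq_nonneg h)
    linarith
  · have hc0 : 0 ≤ c₂ := (abs_nonneg _).trans (hc₂ p ⟨le_rfl, by linarith⟩)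
    refine (ciInf_le ⟨0, ?_⟩ (f' (p + h))).trans
      ((ciInf_le ⟨0, ?_⟩ (f (p + h) - f' (p + h) * (p + h))).trans ?_)
    · rintro _ ⟨a, rfl⟩
      exact Real.iInf_nonneg (hnn a)
    · rintro _ ⟨b, rfl⟩
      exact hnn _ b
    · exact Real.iSup_le (fun x => Real.iSup_le
        (fun hx => abs_sub_midpoint_tangent_le hh hf' hf'' hc₂ hx) (by positivity)) (by positivity)

/-- **Lemma (sufficient condition for uniform nonlinearity).**
Let `f : [0,1] → ℝ` be twice differentiable with `0 < c₁ < |f''(x)| < c₂` on `[0,1]`.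
For a positive integer `M` and `0 ≤ k ≤ M−1`, let
`m_k = inf_{a,b} sup_{x ∈ [k/M,(k+1)/M]} |f(x) − (a x + b)|`.
Then `c₁/(16M²) ≤ m_k ≤ c₂/(2M²)` for every `M` and `k < M`, and consequently `f`
satisfies the uniform nonlinearity condition: there is `K > 0` with
`M · max_{k<M} m_k² ≤ K · Σ_{k<M} m_k²` for all `M`. -/
theorem UN_condition_of_second_deriv_bounds
    (f f' f'' : ℝ → ℝ) (c₁ c₂ : ℝ) (hc₁ : 0 < c₁) (hc₁₂ : c₁ < c₂)
    (hf' : ∀ x ∈ Icc (0 : ℝ) 1, HasDerivWithinAt f (f' x) (Icc (0 : ℝ) 1) x)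
    (hf'' : ∀ x ∈ Icc (0 : ℝ) 1, HasDerivWithinAt f' (f'' x) (Icc (0 : ℝ) 1) x)
    (hbound : ∀ x ∈ Icc (0 : ℝ) 1, c₁ < |f'' x| ∧ |f'' x| < c₂)
    (m : ℕ → ℕ → ℝ)
    (hm : ∀ M k : ℕ, m M k =
      ⨅ (a : ℝ) (b : ℝ), ⨆ x ∈ Icc ((k : ℝ) / M) (((k : ℝ) + 1) / M), |f x - (a * x + b)|) :
    (∀ M : ℕ, 0 < M → ∀ k < M,
        c₁ / (16 * (M : ℝ) ^ 2) ≤ m M k ∧ m M k ≤ c₂ / (2 * (M : ℝ) ^ 2)) ∧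
    ∃ K > (0 : ℝ), ∀ M : ℕ, 0 < M → ∀ k < M,
        (M : ℝ) * m M k ^ 2 ≤ K * ∑ j ∈ Finset.range M, m M j ^ 2 := by
  have bounds : ∀ M : ℕ, 0 < M → ∀ k < M,
      c₁ / (16 * (M : ℝ) ^ 2) ≤ m M k ∧ m M k ≤ c₂ / (2 * (M : ℝ) ^ 2) := by
    intro M hM k hk
    have hM' : (0 : ℝ) < M := by exact_mod_cast hM
    have hk' : (k : ℝ) + 1 ≤ M := by exact_mod_cast hk
    have hend : ((k : ℝ) + 1) / M = k / M + 2 * (1 / (2 * M)) := by field_simp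
    have hsub : Icc ((k : ℝ) / M) (k / M + 2 * (1 / (2 * M))) ⊆ Icc (0 : ℝ) 1 := by
      rw [← hend]
      exact Icc_subset_Icc (by positivity) ((div_le_one hM').2 hk')
    obtain ⟨hlow, hupp⟩ := affine_approx_error_bounds (p := (k : ℝ) / M)
      (h := 1 / (2 * (M : ℝ))) (by positivity)
      (fun x hx => (hf' x (hsub hx)).mono hsub) (fun x hx => (hf'' x (hsub hx)).mono hsub)
      (fun x hx => (hbound x (hsub hx)).1.le) (fun x hx => (hbound x (hsub hx)).2.le)
    rw [hm, hend]
    refine ⟨le_trans (le_of_eq ?_) hlow, hupp.trans ?_⟩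
    · field_simp
      norm_num
    · have hc₂ : 0 < c₂ := hc₁.trans hc₁₂
      have : c₂ * (1 / (2 * (M : ℝ))) ^ 2 = c₂ / (2 * (M : ℝ) ^ 2) / 2 := by
        field_simp
      rw [this]
      exact half_le_self (by positivity)
  refine ⟨bounds, 64 * c₂ ^ 2 / c₁ ^ 2, ?_, fun M hM k hk => ?_⟩
  · have hc₂ : 0 < c₂ := hc₁.trans hc₁₂
    positivity
  · have hM' : (0 : ℝ) < M := by exact_mod_cast hM
    have hsum : (M : ℝ) * (c₁ / (16 * (M : ℝ) ^ 2)) ^ 2 ≤ ∑ j ∈ Finset.range M, m M j ^ 2 := by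
      have := Finset.card_nsmul_le_sum (Finset.range M) (fun j => m M j ^ 2)
        ((c₁ / (16 * (M : ℝ) ^ 2)) ^ 2) fun j hj =>
          pow_le_pow_left₀ (by positivity) (bounds M hM j (Finset.mem_range.1 hj)).1 2
      simpa using this
    have hlow : 0 ≤ m M k := le_trans (by positivity) (bounds M hM k hk).1
    calc (M : ℝ) * m M k ^ 2 ≤ M * (c₂ / (2 * (M : ℝ) ^ 2)) ^ 2 := by
          gcongr
          exact (bounds M hM k hk).2
      _ = 64 * c₂ ^ 2 / c₁ ^ 2 * (M * (c₁ / (16 * (M : ℝ) ^ 2)) ^ 2) := by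
          field_simp
          ring
      _ ≤ _ := by gcongr
end

section
/- Fix κ > 0 and an even integer N ≥ 4, set c = κ²/N², define the sequence (a_i) by a₀ = 0, a₁ = 1, a_{i+1} = (2+c) a_i − a_{i−1}, and let X_N be the (N−1)×(N−1) matrix with (X_N)_{ij} = a_{min(i,j)} a_{N−max(i,j)} / a_N. Then for every integer k ≥ 1 and all 1 ≤ i ≤ j ≤ N/2: (1) (X_N^k)_{N/2, N/2} ≥ a_{N/2}² · ( Σ_{l=1}^{N−1} a_{min(l, N−l)}² )^{k−1} / a_N^{k}; (2) (X_N^k)_{N/2, i} = (X_N^k)_{N/2, N−i}; (3) (X_N^k)_{N/2, i} ≤ (X_N^k)_{N/2, j}; (4) (X_N^k)_{N/2, i} ≥ (a_i / a_{N/2}) · (X_N^k)_{N/2, N/2}. -/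
/-- The discrete Green kernel `a_{min(l,i)} a_{N-max(l,i)} / a_N`, indexed by natural numbers. -/
noncomputable def greenKernel (a : ℕ → ℝ) (N l i : ℕ) : ℝ :=
  a (min l i) * a (N - max l i) / a N

/-- The row of index `M` of the `k`-th power of the Green kernel on `{1, …, N - 1}`. -/
noncomputable def greenRow (a : ℕ → ℝ) (N M : ℕ) : ℕ → ℕ → ℝ
  | 0, i => if i = M then 1 else 0
  | k + 1, i => ∑ l ∈ Finset.Ico 1 N, greenRow a N M k l * greenKernel a N l i

section Recurrence

variable {c : ℝ} {a : ℕ → ℝ}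

theorem nonneg_and_le_succ_of_rec (hc : 0 < c) (ha0 : a 0 = 0) (ha1 : a 1 = 1)
    (hrec : ∀ i, a (i + 2) = (2 + c) * a (i + 1) - a i) (n : ℕ) : 0 ≤ a n ∧ a n ≤ a (n + 1) := by
  induction n with
  | zero => simp [ha0, ha1]
  | succ n ih =>
    have := hrec n
    have h : 0 ≤ a (n + 1) := ih.1.trans ih.2
    exact ⟨h, by nlinarith [ih.2, mul_nonneg hc.le h]⟩

theorem monotone_of_rec (hc : 0 < c) (ha0 : a 0 = 0) (ha1 : a 1 = 1)
    (hrec : ∀ i, a (i + 2) = (2 + c) * a (i + 1) - a i) : Monotone a :=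
  monotone_nat_of_le_succ fun n => (nonneg_and_le_succ_of_rec hc ha0 ha1 hrec n).2

theorem pos_of_rec (hc : 0 < c) (ha0 : a 0 = 0) (ha1 : a 1 = 1)
    (hrec : ∀ i, a (i + 2) = (2 + c) * a (i + 1) - a i) {n : ℕ} (hn : 1 ≤ n) : 0 < a n := by
  have := monotone_of_rec hc ha0 ha1 hrec hn
  linarith

theorem wronskian_of_rec (ha0 : a 0 = 0) (ha1 : a 1 = 1)
    (hrec : ∀ i, a (i + 2) = (2 + c) * a (i + 1) - a i) (m n : ℕ) :
    a (m + 1) * a (n + 1) - a m * a n = a (m + n + 1) := by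
  induction n generalizing m with
  | zero => simp [ha0, ha1]
  | succ n ih =>
    have h := ih (m + 1)
    rw [show m + (n + 1) + 1 = m + 1 + n + 1 by omega, ← h, hrec n, hrec m]
    ring

end Recurrence

section Kernel

variable {c : ℝ} {a : ℕ → ℝ} {N M : ℕ}

theorem greenKernel_reflect {l i : ℕ} (hl : l ≤ N) (hi : i ≤ N) :
    greenKernel a N (N - l) (N - i) = greenKernel a N l i := by
  unfold greenKernel
  rw [show min (N - l) (N - i) = N - max l i by omega,
    show N - max (N - l) (N - i) = min l i by omega]
  ring

theorem greenKernel_nonneg (ha : ∀ n, 0 ≤ a n) (l i : ℕ) : 0 ≤ greenKernel a N l i :=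
  div_nonneg (mul_nonneg (ha _) (ha _)) (ha _)

theorem greenKernel_zero_right (ha0 : a 0 = 0) (l : ℕ) : greenKernel a N l 0 = 0 := by
  simp [greenKernel, ha0]

theorem greenKernel_mid (hNM : N = M + M) {l : ℕ} (hl : l ≤ N) :
    greenKernel a N l M = a (min l (N - l)) * a M / a N := by
  unfold greenKernel
  rcases le_total l M with h | h
  · rw [min_eq_left h, max_eq_right h, min_eq_left (by omega), show N - M = M by omega]
  · rw [min_eq_right h, max_eq_left h, min_eq_right (by omega)]
    ring

/-- The Green kernel inverts the operator `(2 + c) u_i - u_{i-1} - u_{i+1}`. -/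
theorem greenKernel_rec (ha0 : a 0 = 0) (ha1 : a 1 = 1)
    (hrec : ∀ i, a (i + 2) = (2 + c) * a (i + 1) - a i) (haN : a N ≠ 0)
    (l i : ℕ) (hl : l < N) (hi : i + 1 < N) :
    (2 + c) * greenKernel a N l (i + 1) - greenKernel a N l i - greenKernel a N l (i + 2)
      = if l = i + 1 then 1 else 0 := by
  unfold greenKernel
  rcases lt_trichotomy l (i + 1) with h | h | h
  · rw [if_neg h.ne, min_eq_left (by omega), min_eq_left (by omega), min_eq_left (by omega),
      max_eq_right (by omega), max_eq_right (by omega), max_eq_right (by omega)]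
    obtain ⟨n, rfl⟩ : ∃ n, N = i + 2 + n := ⟨N - (i + 2), by omega⟩
    rw [show i + 2 + n - (i + 1) = n + 1 by omega, show i + 2 + n - i = n + 2 by omega,
      show i + 2 + n - (i + 2) = n by omega, hrec n]
    ring
  · subst h
    rw [if_pos rfl, min_self, max_self, min_eq_right (by omega), min_eq_left (by omega),
      max_eq_left (by omega), max_eq_right (by omega)]
    obtain ⟨n, rfl⟩ : ∃ n, N = i + 2 + n := ⟨N - (i + 2), by omega⟩
    rw [show i + 2 + n - (i + 1) = n + 1 by omega, show i + 2 + n - (i + 2) = n by omega]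
    have h := wronskian_of_rec ha0 ha1 hrec (i + 1) n
    rw [show i + 1 + n + 1 = i + 2 + n by omega, show i + 1 + 1 = i + 2 by omega, hrec i] at h
    field_simp
    linarith
  · rw [if_neg h.ne', min_eq_right (by omega), min_eq_right (by omega), min_eq_right (by omega),
      max_eq_left (by omega), max_eq_left (by omega), max_eq_left (by omega), hrec i]
    ring

theorem mul_greenKernel_mid_le (ha : ∀ n, 0 ≤ a n) (hmono : Monotone a) (hNM : N = M + M)
    (l : ℕ) {i : ℕ} (hi : i ≤ M) :
    a i * greenKernel a N l M ≤ a M * greenKernel a N l i := by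
  unfold greenKernel
  rw [← mul_div_assoc, ← mul_div_assoc]
  refine div_le_div_of_nonneg_right ?_ (ha N)
  rcases le_total l i with h | h
  · rw [min_eq_left h, max_eq_right h, min_eq_left (h.trans hi), max_eq_right (h.trans hi),
      show N - M = M by omega]
    have := mul_le_mul_of_nonneg_left (hmono (show i ≤ N - i by omega))
      (mul_nonneg (ha l) (ha M))
    linarith
  · rw [min_eq_right h, max_eq_left h]
    rcases le_total l M with h' | h'
    · rw [min_eq_left h', max_eq_right h', show N - M = M by omega]
      have := mul_le_mul_of_nonneg_left (hmono (show l ≤ N - l by omega))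
        (mul_nonneg (ha i) (ha M))
      linarith
    · rw [min_eq_right h', max_eq_left h']
      linarith

end Kernel

/-- Discrete minimum principle: a symmetric solution of `(2 + c) u_i - u_{i-1} - u_{i+1} = v_i`
with `u_0 = 0 ≤ u_1` increases up to the centre if `v` does. -/
theorem le_succ_of_discrete_poisson {c : ℝ} (hc : 0 < c) {M : ℕ} {u v : ℕ → ℝ}
    (huv : ∀ i, i + 1 ≤ M → (2 + c) * u (i + 1) - u i - u (i + 2) = v (i + 1))
    (hv : ∀ i, 1 ≤ i → i < M → v i ≤ v (i + 1)) (hu : u 0 ≤ u 1)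
    (hsymm : ∀ i, i + 1 = M → u (i + 2) = u i) {i : ℕ} (hi : i < M) : u i ≤ u (i + 1) := by
  obtain ⟨m, hm, hmin⟩ := Finset.exists_min_image (Finset.range M) (fun i => u (i + 1) - u i)
    ⟨i, Finset.mem_range.2 hi⟩
  rw [Finset.mem_range] at hm
  suffices h : 0 ≤ u (m + 1) - u m by
    have := hmin i (Finset.mem_range.2 hi)
    linarith
  by_contra! hneg
  obtain _ | m := m
  · linarith
  have hleft := hmin m (Finset.mem_range.2 (by omega))
  have hright : u (m + 1 + 1) - u (m + 1) ≤ u (m + 3) - u (m + 2) := by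
    rcases Nat.lt_or_ge (m + 2) M with h | h
    · exact hmin (m + 2) (Finset.mem_range.2 h)
    · have := hsymm (m + 1) (by omega)
      linarith
  have h₁ := huv m (by omega)
  have h₂ := huv (m + 1) (by omega)
  have h₃ := hv (m + 1) (by omega) hm
  have h₄ := mul_neg_of_pos_of_neg hc hneg
  simp only [show m + 1 + 1 = m + 2 from rfl, show m + 1 + 2 = m + 3 from rfl] at *
  linarith

section Row

variable {c : ℝ} {a : ℕ → ℝ} {N M : ℕ}

theorem greenRow_nonneg (ha : ∀ n, 0 ≤ a n) (k i : ℕ) : 0 ≤ greenRow a N M k i := by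
  induction k generalizing i with
  | zero => unfold greenRow; split_ifs <;> norm_num
  | succ k ih =>
    unfold greenRow
    exact Finset.sum_nonneg fun l _ => mul_nonneg (ih l) (greenKernel_nonneg ha l i)

theorem greenRow_reflect (hNM : N = M + M) (k : ℕ) {i : ℕ} (hi : i ≤ N) :
    greenRow a N M k (N - i) = greenRow a N M k i := by
  induction k generalizing i with
  | zero =>
    unfold greenRow
    exact if_congr (by omega) rfl rfl
  | succ k ih =>
    unfold greenRow
    refine Finset.sum_nbij' (N - ·) (N - ·) ?_ ?_ ?_ ?_ ?_ <;> intro l hl <;>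
      rw [Finset.mem_Ico] at hl
    · exact Finset.mem_Ico.2 (by omega)
    · exact Finset.mem_Ico.2 (by omega)
    · exact Nat.sub_sub_self hl.2.le
    · exact Nat.sub_sub_self hl.2.le
    · have h := greenKernel_reflect (a := a) (N := N) (l := l) (i := N - i) hl.2.le (by omega)
      rw [Nat.sub_sub_self hi] at h
      rw [ih hl.2.le, h]

theorem greenRow_succ_rec (ha0 : a 0 = 0) (ha1 : a 1 = 1)
    (hrec : ∀ i, a (i + 2) = (2 + c) * a (i + 1) - a i) (haN : a N ≠ 0)
    (k : ℕ) {i : ℕ} (hi : i + 1 < N) :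
    (2 + c) * greenRow a N M (k + 1) (i + 1) - greenRow a N M (k + 1) i
      - greenRow a N M (k + 1) (i + 2) = greenRow a N M k (i + 1) := by
  simp only [greenRow]
  rw [Finset.mul_sum, ← Finset.sum_sub_distrib, ← Finset.sum_sub_distrib]
  trans ∑ l ∈ Finset.Ico 1 N, if l = i + 1 then greenRow a N M k l else 0
  · refine Finset.sum_congr rfl fun l hl => ?_
    have h := greenKernel_rec ha0 ha1 hrec haN l i (Finset.mem_Ico.1 hl).2 hi
    rw [← mul_boole, ← h]
    ring
  · rw [Finset.sum_ite_eq', if_pos (Finset.mem_Ico.2 (by omega))]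

theorem greenRow_le_succ (hc : 0 < c) (ha0 : a 0 = 0) (ha1 : a 1 = 1)
    (hrec : ∀ i, a (i + 2) = (2 + c) * a (i + 1) - a i) (hNM : N = M + M)
    (k : ℕ) {i : ℕ} (hi : i < M) : greenRow a N M k i ≤ greenRow a N M k (i + 1) := by
  have ha n := (nonneg_and_le_succ_of_rec hc ha0 ha1 hrec n).1
  induction k generalizing i with
  | zero =>
    simp only [greenRow, if_neg hi.ne]
    split_ifs <;> norm_num
  | succ k ih =>
    refine le_succ_of_discrete_poisson hc (M := M) (v := greenRow a N M k)
      (fun i hi => greenRow_succ_rec ha0 ha1 hrec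
        (pos_of_rec hc ha0 ha1 hrec (by omega)).ne' k (by omega))
      (fun i _ hi => ih hi) ?_ ?_ hi
    · rw [show greenRow a N M (k + 1) 0 = 0 by simp [greenRow, greenKernel_zero_right ha0]]
      exact greenRow_nonneg ha _ _
    · intro i hi
      rw [← greenRow_reflect hNM (k + 1) (show i ≤ N by omega), show N - i = i + 2 by omega]

theorem mul_greenRow_mid_le (ha : ∀ n, 0 ≤ a n) (hmono : Monotone a) (hNM : N = M + M)
    (k : ℕ) {i : ℕ} (hi : i ≤ M) :
    a i * greenRow a N M (k + 1) M ≤ a M * greenRow a N M (k + 1) i := by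
  simp only [greenRow, Finset.mul_sum]
  refine Finset.sum_le_sum fun l _ => ?_
  have := mul_le_mul_of_nonneg_left (mul_greenKernel_mid_le ha hmono hNM l hi)
    (greenRow_nonneg (N := N) (M := M) ha k l)
  linarith

theorem greenRow_one_mid (hNM : N = M + M) (hM : 1 ≤ M) :
    greenRow a N M 1 M = a M ^ 2 / a N := by
  simp only [greenRow, ite_mul, one_mul, zero_mul]
  rw [Finset.sum_ite_eq', if_pos (Finset.mem_Ico.2 (by omega)), greenKernel_mid hNM (by omega),
    show min M (N - M) = M by omega, sq]

theorem le_greenRow_mid (ha : ∀ n, 0 ≤ a n) (hmono : Monotone a) (hNM : N = M + M)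
    (hM : 1 ≤ M) (haN : 0 < a N) (k : ℕ) :
    a M ^ 2 * (∑ l ∈ Finset.Ico 1 N, a (min l (N - l)) ^ 2) ^ k / a N ^ (k + 1)
      ≤ greenRow a N M (k + 1) M := by
  induction k with
  | zero => simp [greenRow_one_mid hNM hM]
  | succ k ih =>
    set S := ∑ l ∈ Finset.Ico 1 N, a (min l (N - l)) ^ 2 with hS
    have hS0 : 0 ≤ S := Finset.sum_nonneg fun l _ => sq_nonneg _
    calc a M ^ 2 * S ^ (k + 1) / a N ^ (k + 1 + 1)
        = S / a N * (a M ^ 2 * S ^ k / a N ^ (k + 1)) := by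
          rw [pow_succ S, pow_succ (a N) (k + 1), div_mul_div_comm]
          ring
      _ ≤ S / a N * greenRow a N M (k + 1) M :=
          mul_le_mul_of_nonneg_left ih (div_nonneg hS0 haN.le)
      _ = ∑ l ∈ Finset.Ico 1 N,
            a (min l (N - l)) / a N * (a (min l (N - l)) * greenRow a N M (k + 1) M) := by
          rw [hS, Finset.sum_div, Finset.sum_mul]
          exact Finset.sum_congr rfl fun l _ => by ring
      _ ≤ ∑ l ∈ Finset.Ico 1 N, greenRow a N M (k + 1) l * greenKernel a N l M := by
          refine Finset.sum_le_sum fun l hl => ?_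
          have hlN := (Finset.mem_Ico.1 hl).2.le
          have hsymm : greenRow a N M (k + 1) (min l (N - l)) = greenRow a N M (k + 1) l := by
            rcases min_choice l (N - l) with h | h <;> rw [h]
            exact greenRow_reflect hNM _ hlN
          have h := mul_le_mul_of_nonneg_left
            (mul_greenRow_mid_le ha hmono hNM k (show min l (N - l) ≤ M by omega))
            (div_nonneg (ha (min l (N - l))) haN.le)
          rw [hsymm] at h
          rw [greenKernel_mid hNM hlN]
          exact h.trans_eq (by ring)
      _ = greenRow a N M (k + 1 + 1) M := by simp only [greenRow]

theorem pow_apply_eq_greenRow (X : Matrix (Fin (N - 1)) (Fin (N - 1)) ℝ)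
    (hX : ∀ i j, X i j = greenKernel a N (i + 1) (j + 1))
    {mid : Fin (N - 1)} (hmid : (mid : ℕ) + 1 = M) (k : ℕ) (i : Fin (N - 1)) :
    (X ^ k) mid i = greenRow a N M k (i + 1) := by
  induction k generalizing i with
  | zero =>
    simp only [pow_zero, Matrix.one_apply, greenRow]
    exact if_congr (by rw [Fin.ext_iff]; omega) rfl rfl
  | succ k ih =>
    rw [pow_succ, Matrix.mul_apply, greenRow, Finset.sum_Ico_eq_sum_range, Finset.sum_range]
    refine Finset.sum_congr rfl fun l _ => ?_
    rw [ih, hX, add_comm 1]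

end Row

/-- **Lemma (properties of powers of `X_N`).**
With `c = κ²/N²`, `a₀ = 0`, `a₁ = 1`, `a_{i+1} = (2+c) a_i − a_{i−1}`, `N ≥ 4` even, and
`X_N` the `(N−1)×(N−1)` matrix with `(X_N)_{ij} = a_{min(i,j)} a_{N−max(i,j)} / a_N`
(1-based indices, represented by `Fin (N−1)` indices shifted by one), for every `k ≥ 1`
(with the centre row indexed by `N/2`):
(1) `(X_N^k)_{N/2,N/2} ≥ a_{N/2}² (Σ_{l=1}^{N−1} a_{min(l,N−l)}²)^{k−1} / a_N^k`;
(2) `(X_N^k)_{N/2,i} = (X_N^k)_{N/2,N−i}` for `1 ≤ i ≤ N/2`;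
(3) `(X_N^k)_{N/2,i} ≤ (X_N^k)_{N/2,j}` for `1 ≤ i ≤ j ≤ N/2`;
(4) `(X_N^k)_{N/2,i} ≥ (a_i/a_{N/2}) (X_N^k)_{N/2,N/2}` for `1 ≤ i ≤ N/2`. -/
theorem X_power_properties
    (κ : ℝ) (hκ : 0 < κ) (N : ℕ) (hN : 4 ≤ N) (hNeven : Even N)
    (c : ℝ) (hc : c = κ ^ 2 / (N : ℝ) ^ 2)
    (a : ℕ → ℝ) (ha0 : a 0 = 0) (ha1 : a 1 = 1)
    (harec : ∀ i : ℕ, 1 ≤ i → a (i + 1) = (2 + c) * a i - a (i - 1))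
    (X : Matrix (Fin (N - 1)) (Fin (N - 1)) ℝ)
    (hX : ∀ i j : Fin (N - 1), X i j =
      a (min ((i : ℕ) + 1) ((j : ℕ) + 1)) * a (N - max ((i : ℕ) + 1) ((j : ℕ) + 1)) / a N)
    (k : ℕ) (hk : 1 ≤ k)
    (mid : Fin (N - 1)) (hmid : (mid : ℕ) + 1 = N / 2) :
    a (N / 2) ^ 2 * (∑ l ∈ Finset.Ico 1 N, a (min l (N - l)) ^ 2) ^ (k - 1) / a N ^ k ≤
        (X ^ k) mid mid ∧
    (∀ i i' : Fin (N - 1), (i : ℕ) + 1 ≤ N / 2 → (i' : ℕ) + 1 = N - ((i : ℕ) + 1) →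
        (X ^ k) mid i = (X ^ k) mid i') ∧
    (∀ i j : Fin (N - 1), (i : ℕ) ≤ (j : ℕ) → (j : ℕ) + 1 ≤ N / 2 →
        (X ^ k) mid i ≤ (X ^ k) mid j) ∧
    (∀ i : Fin (N - 1), (i : ℕ) + 1 ≤ N / 2 →
        a ((i : ℕ) + 1) / a (N / 2) * (X ^ k) mid mid ≤ (X ^ k) mid i) := by
  obtain ⟨M, hNM⟩ := hNeven
  have hM : N / 2 = M := by omega
  rw [hM] at hmid ⊢
  have hN0 : (0 : ℝ) < N := by exact_mod_cast (by omega : 0 < N)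
  have hc0 : 0 < c := hc ▸ by positivity
  have hrec i : a (i + 2) = (2 + c) * a (i + 1) - a i := harec (i + 1) (by omega)
  have ha n := (nonneg_and_le_succ_of_rec hc0 ha0 ha1 hrec n).1
  have hmono := monotone_of_rec hc0 ha0 ha1 hrec
  have haN : 0 < a N := pos_of_rec hc0 ha0 ha1 hrec (by omega)
  have haM : 0 < a M := pos_of_rec hc0 ha0 ha1 hrec (by omega)
  obtain ⟨k, rfl⟩ : ∃ n, k = n + 1 := ⟨k - 1, by omega⟩
  simp only [pow_apply_eq_greenRow X hX hmid, hmid, Nat.add_sub_cancel]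
  refine ⟨le_greenRow_mid ha hmono hNM (by omega) haN k, ?_, ?_, ?_⟩
  · intro i i' _ hi'
    rw [hi', greenRow_reflect hNM _ (by omega)]
  · intro i j hij hj
    refine Nat.le_induction (m := (i : ℕ) + 1)
      (P := fun n _ => n ≤ M → greenRow a N M (k + 1) (i + 1) ≤ greenRow a N M (k + 1) n)
      (fun _ => le_rfl) ?_ ((j : ℕ) + 1) (by omega) hj
    intro n _ ih hn
    exact (ih (by omega)).trans (greenRow_le_succ hc0 ha0 ha1 hrec hNM _ hn)
  · intro i hi
    rw [div_mul_eq_mul_div, div_le_iff₀ haM, mul_comm _ (a M)]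
    exact mul_greenRow_mid_le ha hmono hNM k hi
end

section
/- Fix κ > 0 and an even integer N ≥ 2, set c = κ²/N², define the sequence (a_i) by a₀ = 0, a₁ = 1, a_{i+1} = (2+c) a_i − a_{i−1}, and let X_N be the (N−1)×(N−1) matrix with (X_N)_{ij} = a_{min(i,j)} a_{N−max(i,j)} / a_N. Then the largest entry of the matrix (κ²/N²) X_N equals κ² a_{N/2}² / (N² a_N), which is at most κ² / (4N); moreover, for every integer j ≥ 1, every entry of the matrix power ((κ²/N²) X_N)^{j} is at most κ^{2j} / (2^{2j} N). -/
section Recurrence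

variable {a : ℕ → ℝ} {c : ℝ}

theorem recurrence_nonneg_and_lt_succ (hc : 0 ≤ c) (h0 : a 0 = 0) (h1 : a 1 = 1)
    (h : ∀ i, a (i + 2) = (2 + c) * a (i + 1) - a i) (i : ℕ) :
    0 ≤ a i ∧ a i < a (i + 1) := by
  induction i with
  | zero => simp [h0, h1]
  | succ i ih =>
    obtain ⟨hi, hlt⟩ := ih
    have := mul_nonneg hc (hi.trans hlt.le)
    exact ⟨hi.trans hlt.le, by linarith [h i]⟩

theorem recurrence_strictMono (hc : 0 ≤ c) (h0 : a 0 = 0) (h1 : a 1 = 1)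
    (h : ∀ i, a (i + 2) = (2 + c) * a (i + 1) - a i) : StrictMono a :=
  strictMono_nat_of_lt_succ fun i => (recurrence_nonneg_and_lt_succ hc h0 h1 h i).2

theorem recurrence_cross_sub (h0 : a 0 = 0) (h1 : a 1 = 1)
    (h : ∀ i, a (i + 2) = (2 + c) * a (i + 1) - a i) (m i : ℕ) :
    a (i + 1) * a (i + m) - a i * a (i + m + 1) = a m := by
  induction i with
  | zero => simp [h0, h1]
  | succ i ih =>
    rw [show i + 1 + m + 1 = i + m + 2 by ring, show i + 1 + m = i + m + 1 by ring, h i, h (i + m)]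
    linarith

theorem recurrence_add (h0 : a 0 = 0) (h1 : a 1 = 1)
    (h : ∀ i, a (i + 2) = (2 + c) * a (i + 1) - a i) (m k : ℕ) :
    a (m + k + 1) = a (m + 1) * a (k + 1) - a m * a k := by
  induction m generalizing k with
  | zero => simp [h0, h1]
  | succ m ih =>
    rw [show m + 1 + k + 1 = m + (k + 1) + 1 by ring, ih, h m, h k]
    ring

theorem recurrence_ratio (hc : 0 ≤ c) (h0 : a 0 = 0) (h1 : a 1 = 1)
    (h : ∀ i, a (i + 2) = (2 + c) * a (i + 1) - a i) (n : ℕ) :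
    (n + 1) * a n ≤ n * a (n + 1) := by
  induction n with
  | zero => simp [h0]
  | succ n ih =>
    have hp : 0 ≤ ((n : ℝ) + 1) * (c * a (n + 1)) :=
      mul_nonneg (by positivity) (mul_nonneg hc (recurrence_nonneg_and_lt_succ hc h0 h1 h (n + 1)).1)
    rw [h n]
    push_cast
    linarith

theorem two_mul_sq_le_recurrence (hc : 0 ≤ c) (h0 : a 0 = 0) (h1 : a 1 = 1)
    (h : ∀ i, a (i + 2) = (2 + c) * a (i + 1) - a i) (n : ℕ) :
    2 * a n ^ 2 ≤ n * a (n + n) := by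
  rcases n with _ | m
  · simp [h0]
  have hr := recurrence_ratio hc h0 h1 h m
  have hpos := (recurrence_nonneg_and_lt_succ hc h0 h1 h (m + 1)).1
  have hadd := recurrence_add h0 h1 h (m + 1) m
  rw [show m + 1 + m + 1 = m + 1 + (m + 1) by ring, show m + 1 + 1 = m + 2 by ring, h m] at hadd
  have hp : 0 ≤ ((m : ℝ) + 1) * (c * a (m + 1)) := mul_nonneg (by positivity) (mul_nonneg hc hpos)
  rw [hadd]
  push_cast
  have key : 2 * a (m + 1) ≤ (m + 1) * ((2 + c) * a (m + 1) - a m - a m) := by linarith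
  nlinarith [mul_le_mul_of_nonneg_left key hpos]

theorem recurrence_mul_add_two_mul_le_sq (hc : 0 ≤ c) (h0 : a 0 = 0) (h1 : a 1 = 1)
    (h : ∀ i, a (i + 2) = (2 + c) * a (i + 1) - a i) (i d : ℕ) :
    a i * a (i + 2 * d) ≤ a (i + d) ^ 2 := by
  induction d generalizing i with
  | zero => simp [sq]
  | succ d ih =>
    have hx := recurrence_cross_sub h0 h1 h (2 * d + 1) i
    have hp := (recurrence_nonneg_and_lt_succ hc h0 h1 h (2 * d + 1)).1
    have := ih (i + 1)
    rw [show i + 1 + 2 * d = i + (2 * d + 1) by ring, show i + 1 + d = i + (d + 1) by ring] at this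
    rw [show i + 2 * (d + 1) = i + (2 * d + 1) + 1 by ring]
    linarith

theorem recurrence_mul_le_sq (hc : 0 ≤ c) (h0 : a 0 = 0) (h1 : a 1 = 1)
    (h : ∀ i, a (i + 2) = (2 + c) * a (i + 1) - a i) {i k n : ℕ} (hik : i + k ≤ n + n) :
    a i * a k ≤ a n ^ 2 := by
  have hmono := (recurrence_strictMono hc h0 h1 h).monotone
  have hnn := fun i => (recurrence_nonneg_and_lt_succ hc h0 h1 h i).1
  wlog hle : i ≤ k generalizing i k
  · rw [mul_comm]
    exact this (by omega) (by omega)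
  obtain ⟨d, rfl⟩ : ∃ d, n = i + d := ⟨n - i, by omega⟩
  calc a i * a k ≤ a i * a (i + 2 * d) :=
        mul_le_mul_of_nonneg_left (hmono (by omega)) (hnn i)
    _ ≤ a (i + d) ^ 2 := recurrence_mul_add_two_mul_le_sq hc h0 h1 h i d

end Recurrence

theorem Matrix.pow_succ_apply_le {n : ℕ} (Y : Matrix (Fin n) (Fin n) ℝ) {M : ℝ}
    (hY0 : ∀ p q, 0 ≤ Y p q) (hY : ∀ p q, Y p q ≤ M) (j : ℕ) (p q : Fin n) :
    0 ≤ (Y ^ (j + 1)) p q ∧ (Y ^ (j + 1)) p q ≤ n ^ j * M ^ (j + 1) := by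
  have hM : 0 ≤ M := (hY0 p q).trans (hY p q)
  induction j generalizing p q with
  | zero => simpa using ⟨hY0 p q, hY p q⟩
  | succ j ih =>
    rw [pow_succ, Matrix.mul_apply]
    refine ⟨Finset.sum_nonneg fun r _ => mul_nonneg (ih p r).1 (hY0 r q), ?_⟩
    calc ∑ r, (Y ^ (j + 1)) p r * Y r q ≤ ∑ _r : Fin n, (n : ℝ) ^ j * M ^ (j + 1) * M :=
          Finset.sum_le_sum fun r _ =>
            mul_le_mul (ih p r).2 (hY r q) (hY0 r q) (by positivity)
      _ = n ^ (j + 1) * M ^ (j + 1 + 1) := by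
          simp only [Finset.sum_const, Finset.card_univ, Fintype.card_fin, nsmul_eq_mul]
          ring

/-- With `c = κ²/N²`, `a₀ = 0`, `a₁ = 1`, `a_{i+1} = (2+c) a_i − a_{i−1}`, `N ≥ 2` even,
and `X_N` the `(N−1)×(N−1)` matrix with `(X_N)_{ij} = a_{min(i,j)} a_{N−max(i,j)} / a_N`
(1-based indices, represented by `Fin (N−1)` indices shifted by one):
the largest entry of `(κ²/N²) X_N` equals `κ² a_{N/2}² / (N² a_N)`, which is at most
`κ²/(4N)`; moreover every entry of `((κ²/N²) X_N)^j` is at most `κ^{2j}/(2^{2j} N)`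
for every `j ≥ 1`. -/
theorem scaled_X_entry_bounds
    (κ : ℝ) (hκ : 0 < κ) (N : ℕ) (hN : 2 ≤ N) (hNeven : Even N)
    (c : ℝ) (hc : c = κ ^ 2 / (N : ℝ) ^ 2)
    (a : ℕ → ℝ) (ha0 : a 0 = 0) (ha1 : a 1 = 1)
    (harec : ∀ i : ℕ, 1 ≤ i → a (i + 1) = (2 + c) * a i - a (i - 1))
    (X : Matrix (Fin (N - 1)) (Fin (N - 1)) ℝ)
    (hX : ∀ i j : Fin (N - 1), X i j =
      a (min ((i : ℕ) + 1) ((j : ℕ) + 1)) * a (N - max ((i : ℕ) + 1) ((j : ℕ) + 1)) / a N) :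
    (∀ i j : Fin (N - 1),
        ((κ ^ 2 / (N : ℝ) ^ 2) • X) i j ≤ κ ^ 2 * a (N / 2) ^ 2 / ((N : ℝ) ^ 2 * a N)) ∧
    (∃ i j : Fin (N - 1),
        ((κ ^ 2 / (N : ℝ) ^ 2) • X) i j = κ ^ 2 * a (N / 2) ^ 2 / ((N : ℝ) ^ 2 * a N)) ∧
    κ ^ 2 * a (N / 2) ^ 2 / ((N : ℝ) ^ 2 * a N) ≤ κ ^ 2 / (4 * (N : ℝ)) ∧
    (∀ j : ℕ, 1 ≤ j → ∀ p q : Fin (N - 1),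
        (((κ ^ 2 / (N : ℝ) ^ 2) • X) ^ j) p q ≤ κ ^ (2 * j) / (2 ^ (2 * j) * (N : ℝ))) := by
  have hNpos : (0 : ℝ) < N := by exact_mod_cast (by omega : 0 < N)
  have hc0 : 0 ≤ c := by rw [hc]; positivity
  have h : ∀ i, a (i + 2) = (2 + c) * a (i + 1) - a i := fun i => by
    simpa using harec (i + 1) (by omega)
  have hnn := fun i => (recurrence_nonneg_and_lt_succ hc0 ha0 ha1 h i).1
  have haN : 0 < a N := by
    simpa [ha0] using recurrence_strictMono hc0 ha0 ha1 h (by omega : 0 < N)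
  obtain ⟨n, hn⟩ := hNeven
  have hhalf : N / 2 = n := by omega
  have hscaled : ∀ p q, ((κ ^ 2 / (N : ℝ) ^ 2) • X) p q = κ ^ 2 *
      (a (min ((p : ℕ) + 1) ((q : ℕ) + 1)) * a (N - max ((p : ℕ) + 1) ((q : ℕ) + 1))) /
        ((N : ℝ) ^ 2 * a N) := fun p q => by
    rw [Matrix.smul_apply, hX, smul_eq_mul]
    field_simp
  have hentry : ∀ p q, ((κ ^ 2 / (N : ℝ) ^ 2) • X) p q ≤
      κ ^ 2 * a (N / 2) ^ 2 / ((N : ℝ) ^ 2 * a N) := fun p q => by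
    rw [hscaled, hhalf]
    gcongr
    exact recurrence_mul_le_sq hc0 ha0 ha1 h (by omega)
  have hmax : κ ^ 2 * a (N / 2) ^ 2 / ((N : ℝ) ^ 2 * a N) ≤ κ ^ 2 / (4 * (N : ℝ)) := by
    have hsq := two_mul_sq_le_recurrence hc0 ha0 ha1 h n
    have hcast : (N : ℝ) = n + n := by exact_mod_cast hn
    rw [← hn] at hsq
    rw [hhalf, div_le_div_iff₀ (by positivity) (by positivity)]
    have hfac : 4 * a n ^ 2 ≤ N * a N := by rw [hcast]; linarith
    calc κ ^ 2 * a n ^ 2 * (4 * N) = κ ^ 2 * N * (4 * a n ^ 2) := by ring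
      _ ≤ κ ^ 2 * N * (N * a N) := by gcongr
      _ = κ ^ 2 * ((N : ℝ) ^ 2 * a N) := by ring
  refine ⟨hentry, ⟨⟨n - 1, by omega⟩, ⟨n - 1, by omega⟩, ?_⟩, hmax, ?_⟩
  · rw [hscaled, hhalf]
    have hn1 : n - 1 + 1 = n := by omega
    have hNn : N - n = n := by omega
    simp only [hn1, min_self, max_self, hNn, sq]
  · rintro (_ | j) hj p q
    · omega
    have hY0 : ∀ p q, 0 ≤ ((κ ^ 2 / (N : ℝ) ^ 2) • X) p q := fun p q => by
      rw [hscaled]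
      exact div_nonneg (mul_nonneg (by positivity) (mul_nonneg (hnn _) (hnn _))) (by positivity)
    have hpow := (Matrix.pow_succ_apply_le _ hY0 (fun p q => (hentry p q).trans hmax) j p q).2
    calc _ ≤ ((N - 1 : ℕ) : ℝ) ^ j * (κ ^ 2 / (4 * (N : ℝ))) ^ (j + 1) := hpow
      _ ≤ (N : ℝ) ^ j * (κ ^ 2 / (4 * (N : ℝ))) ^ (j + 1) := by
          gcongr
          omega
      _ = κ ^ (2 * (j + 1)) / (2 ^ (2 * (j + 1)) * (N : ℝ)) := by
          rw [pow_mul κ, pow_mul (2 : ℝ), div_pow, mul_pow, pow_succ (N : ℝ)]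
          norm_num
          field_simp
end

section
/- Fix κ > 0 and an even integer N with N > κ, set c = κ²/N², and define the sequence (a_i) by a₀ = 0, a₁ = 1, a_{i+1} = (2+c) a_i − a_{i−1}. Let r₁ = 1 + κ²/(2N²) + (κ/N)·√(1 + κ²/(4N²)) and r₂ = 1/r₁ be the roots of x² − (2+c)x + 1 = 0. Then: (1) 1 + κ ≤ r₁^{N} ≤ e^{2κ}; (2) r₁ − r₂ ≤ 4κ/N; and (3) a_{N/2}² / a_N ≥ N / (4(κ + 2)). -/
/-- Binet-type formula for a sequence with characteristic roots `r` and `s`, where `r * s = 1`. -/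
theorem mul_sub_eq_pow_sub_pow_of_recurrence {R : Type*} [CommRing R] {a : ℕ → R} {t r s : R}
    (ha0 : a 0 = 0) (ha1 : a 1 = 1)
    (harec : ∀ i : ℕ, 1 ≤ i → a (i + 1) = t * a i - a (i - 1))
    (hsum : r + s = t) (hprod : r * s = 1) (i : ℕ) :
    a i * (r - s) = r ^ i - s ^ i := by
  induction i using Nat.twoStepInduction with
  | zero => simp [ha0]
  | one => simp [ha1]
  | more n ih₀ ih₁ =>
    have h : a (n + 2) = t * a (n + 1) - a n := harec (n + 1) (by omega)
    rw [h, ← hsum]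
    linear_combination (r + s) * ih₁ - ih₀ + (r ^ n - s ^ n) * hprod

/-- If `p * q = 1` and `1 + κ ≤ p ^ 2`, then `(p - q) / (p + q)` is at least `κ / (κ + 2)`. -/
theorem mul_add_le_add_two_mul_sub {κ p q : ℝ} (hq : 0 < q) (hpq : p * q = 1)
    (hp : 1 + κ ≤ p ^ 2) : κ * (p + q) ≤ (κ + 2) * (p - q) := by
  have h : (1 + κ) * q ≤ p ^ 2 * q := mul_le_mul_of_nonneg_right hp hq.le
  have h' : p ^ 2 * q = p := by linear_combination p * hpq
  linarith

/-- Bounds on `√(1 + x ^ 2 / 4)` for `0 < x < 1`. -/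
theorem sqrt_one_add_sq_div_four_bounds {x : ℝ} (hx0 : 0 < x) (hx1 : x < 1) :
    1 ≤ √(1 + x ^ 2 / 4) ∧ √(1 + x ^ 2 / 4) ≤ 9 / 8 := by
  constructor
  · exact Real.one_le_sqrt.mpr (by nlinarith)
  · exact Real.sqrt_le_iff.mpr ⟨by norm_num, by nlinarith⟩

/-- With `c = κ²/N²`, `a₀ = 0`, `a₁ = 1`, `a_{i+1} = (2+c) a_i − a_{i−1}`, `N` even with
`N > κ`, and `r₁ = 1 + κ²/(2N²) + (κ/N)√(1 + κ²/(4N²))`, `r₂ = 1/r₁` the roots of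
`x² − (2+c)x + 1 = 0`:
(1) `1 + κ ≤ r₁^N ≤ e^{2κ}`; (2) `r₁ − r₂ ≤ 4κ/N`; and
(3) `a_{N/2}²/a_N ≥ N/(4(κ+2))`. -/
theorem root_and_ratio_bounds
    (κ : ℝ) (hκ : 0 < κ) (N : ℕ) (hNeven : Even N) (hκN : κ < (N : ℝ))
    (c : ℝ) (hc : c = κ ^ 2 / (N : ℝ) ^ 2)
    (a : ℕ → ℝ) (ha0 : a 0 = 0) (ha1 : a 1 = 1)
    (harec : ∀ i : ℕ, 1 ≤ i → a (i + 1) = (2 + c) * a i - a (i - 1))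
    (r₁ r₂ : ℝ)
    (hr₁ : r₁ = 1 + κ ^ 2 / (2 * (N : ℝ) ^ 2)
        + (κ / (N : ℝ)) * Real.sqrt (1 + κ ^ 2 / (4 * (N : ℝ) ^ 2)))
    (hr₂ : r₂ = 1 / r₁) :
    (1 + κ ≤ r₁ ^ N ∧ r₁ ^ N ≤ Real.exp (2 * κ)) ∧
    r₁ - r₂ ≤ 4 * κ / (N : ℝ) ∧
    (N : ℝ) / (4 * (κ + 2)) ≤ a (N / 2) ^ 2 / a N := by
  have hN : (0 : ℝ) < N := hκ.trans hκN
  obtain ⟨x, hx⟩ : ∃ x, x = κ / (N : ℝ) := ⟨_, rfl⟩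
  have hNx : N * x = κ := by rw [hx]; field_simp
  have hx0 : 0 < x := hx ▸ div_pos hκ hN
  have hx1 : x < 1 := hx ▸ (div_lt_one hN).mpr hκN
  have hcx : c = x ^ 2 := by rw [hc, hx, div_pow]
  obtain ⟨s, hs⟩ : ∃ s, s = √(1 + x ^ 2 / 4) := ⟨_, rfl⟩
  have hr₁x : r₁ = 1 + x ^ 2 / 2 + x * s := by
    rw [hr₁, hs, hx, div_pow, div_div, div_div, mul_comm (2 : ℝ), mul_comm (4 : ℝ)]
  have hssq : s ^ 2 = 1 + x ^ 2 / 4 := by rw [hs]; exact Real.sq_sqrt (by positivity)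
  obtain ⟨hs1, hs2⟩ : 1 ≤ s ∧ s ≤ 9 / 8 := hs ▸ sqrt_one_add_sq_div_four_bounds hx0 hx1
  have hr₁pos : 0 < r₁ := by rw [hr₁x]; positivity
  have hr₂pos : 0 < r₂ := hr₂ ▸ one_div_pos.mpr hr₁pos
  have hprod : r₁ * r₂ = 1 := by rw [hr₂]; field_simp
  have hr₂x : r₂ = 1 + x ^ 2 / 2 - x * s := by
    apply mul_left_cancel₀ hr₁pos.ne'
    rw [hprod, hr₁x]
    linear_combination x ^ 2 * hssq
  have hlower : 1 + κ ≤ r₁ ^ N := by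
    have hr : 1 + x ≤ r₁ := by rw [hr₁x]; nlinarith
    calc 1 + κ = 1 + N * x := by rw [hNx]
      _ ≤ (1 + x) ^ N := one_add_mul_le_pow (by linarith) N
      _ ≤ r₁ ^ N := pow_le_pow_left₀ (by linarith) hr N
  have hupper : r₁ ^ N ≤ Real.exp (2 * κ) := by
    have hr : r₁ ≤ Real.exp (2 * x) := by
      have := Real.add_one_le_exp (2 * x)
      rw [hr₁x]; nlinarith
    calc r₁ ^ N ≤ Real.exp (2 * x) ^ N := pow_le_pow_left₀ hr₁pos.le hr N
      _ = Real.exp (2 * κ) := by rw [← Real.exp_nat_mul, ← hNx]; ring_nf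
  have hdiff : r₁ - r₂ ≤ 4 * κ / N := by
    rw [mul_div_assoc, ← hx, hr₁x, hr₂x]; nlinarith
  refine ⟨⟨hlower, hupper⟩, hdiff, ?_⟩
  obtain ⟨m, rfl⟩ := hNeven
  have hdpos : 0 < r₁ - r₂ := by rw [hr₁x, hr₂x]; nlinarith
  have hbinet := mul_sub_eq_pow_sub_pow_of_recurrence (r := r₁) (s := r₂) ha0 ha1 harec
    (by rw [hr₁x, hr₂x, hcx]; ring) hprod
  have hp : 0 < r₁ ^ m := pow_pos hr₁pos m
  have hq : 0 < r₂ ^ m := pow_pos hr₂pos m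
  have hpq : r₁ ^ m * r₂ ^ m = 1 := by rw [← mul_pow, hprod, one_pow]
  have hratio := mul_add_le_add_two_mul_sub (κ := κ) hq hpq (by rwa [← pow_mul, mul_two])
  have hsub : 0 < r₁ ^ m - r₂ ^ m := by
    have : 0 < (κ + 2) * (r₁ ^ m - r₂ ^ m) := lt_of_lt_of_le (by positivity) hratio
    exact (pos_iff_pos_of_mul_pos this).mp (by linarith)
  have ham : a m = (r₁ ^ m - r₂ ^ m) / (r₁ - r₂) := eq_div_of_mul_eq hdpos.ne' (hbinet m)
  have haN : a (m + m) = (r₁ ^ m - r₂ ^ m) * (r₁ ^ m + r₂ ^ m) / (r₁ - r₂) :=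
    eq_div_of_mul_eq hdpos.ne' (by rw [hbinet]; ring)
  have heq : a ((m + m) / 2) ^ 2 / a (m + m)
      = (r₁ ^ m - r₂ ^ m) / ((r₁ ^ m + r₂ ^ m) * (r₁ - r₂)) := by
    rw [show (m + m) / 2 = m by omega, haN, ham]
    field_simp
  rw [heq, div_le_div_iff₀ (by positivity) (by positivity)]
  have hNd : (r₁ - r₂) * (m + m : ℕ) ≤ 4 * κ := (le_div_iff₀ hN).mp hdiff
  calc ((m + m : ℕ) : ℝ) * ((r₁ ^ m + r₂ ^ m) * (r₁ - r₂))
      = (r₁ - r₂) * (m + m : ℕ) * (r₁ ^ m + r₂ ^ m) := by ring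
    _ ≤ 4 * κ * (r₁ ^ m + r₂ ^ m) := mul_le_mul_of_nonneg_right hNd (by positivity)
    _ ≤ (r₁ ^ m - r₂ ^ m) * (4 * (κ + 2)) := by linarith
end

section
/- Let A be a symmetric positive definite 2×2 real matrix, let ε > 0, and let 0 < k < 1. Then ∫_{[−kε, kε]²} exp( −(1/2) vᵀ A v ) dv ≥ k² · ∫_{[−ε, ε]²} exp( −(1/2) vᵀ A v ) dv, where the integrals are with respect to Lebesgue measure on ℝ². Equivalently, for a centered bivariate Gaussian vector (w₁, w₂) with positive definite covariance matrix V, P(|w₁| < kε, |w₂| < kε) ≥ k² · P(|w₁| < ε, |w₂| < ε). -/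
open Matrix
open scoped Pointwise

/-- For a symmetric positive definite `2×2` matrix `A`, `ε > 0` and `0 < k < 1`, the
Gaussian-type integral over the box `[−kε, kε]²` is at least `k²` times the integral over
`[−ε, ε]²`:
`∫_{[−kε,kε]²} exp(−½ vᵀAv) dv ≥ k² ∫_{[−ε,ε]²} exp(−½ vᵀAv) dv`. -/
theorem gaussian_box_ratio
    (A : Matrix (Fin 2) (Fin 2) ℝ) (hA : A.IsSymm) (hApd : A.PosDef)
    (ε k : ℝ) (hε : 0 < ε) (hk0 : 0 < k) (hk1 : k < 1) :
    k ^ 2 * ∫ v in Set.Icc (fun _ : Fin 2 => -ε) (fun _ : Fin 2 => ε),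
        Real.exp (-(1 / 2) * (v ⬝ᵥ A.mulVec v)) ≤
      ∫ v in Set.Icc (fun _ : Fin 2 => -(k * ε)) (fun _ : Fin 2 => k * ε),
        Real.exp (-(1 / 2) * (v ⬝ᵥ A.mulVec v)) := by
  have hscale : k • Set.Icc (fun _ : Fin 2 => -ε) (fun _ : Fin 2 => ε) =
      Set.Icc (fun _ : Fin 2 => -(k * ε)) (fun _ : Fin 2 => k * ε) := by
    ext v
    rw [Set.mem_smul_set_iff_inv_smul_mem₀ hk0.ne']
    simp only [Set.mem_Icc, Pi.le_def, Pi.smul_apply, smul_eq_mul, inv_mul_eq_div,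
      le_div_iff₀ hk0, div_le_iff₀ hk0, neg_mul, mul_comm ε k]
  have hcov := MeasureTheory.Measure.setIntegral_comp_smul_of_pos MeasureTheory.volume
    (fun v : Fin 2 → ℝ => Real.exp (-(1 / 2) * (v ⬝ᵥ A.mulVec v)))
    (Set.Icc (fun _ : Fin 2 => -ε) (fun _ : Fin 2 => ε)) hk0
  rw [hscale, Module.finrank_fin_fun, smul_eq_mul, eq_inv_mul_iff_mul_eq₀ (by positivity)] at hcov
  rw [← hcov]
  refine mul_le_mul_of_nonneg_left ?_ (by positivity)
  refine MeasureTheory.setIntegral_mono_on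
    (Continuous.integrableOn_Icc (by fun_prop))
    (Continuous.integrableOn_Icc (by fun_prop))
    measurableSet_Icc fun v _ => Real.exp_le_exp.2 ?_
  have hv : 0 ≤ v ⬝ᵥ A.mulVec v := by simpa using hApd.posSemidef.dotProduct_mulVec_nonneg v
  have hk : k * k ≤ 1 := by nlinarith
  simp only [mulVec_smul, smul_dotProduct, dotProduct_smul, smul_eq_mul]
  nlinarith [mul_le_mul_of_nonneg_right hk hv]
end
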